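/- arXiv:2207.07242 — 9 statements merged into one kernel-verified Lean document; each statement's English description precedes it below -/
import Mathlib

section
/- Let X be a Hausdorff topological space that is path connected (i.e., any two points of X are joined by a continuous map from the closed unit interval [0,1] into X). Then X is arcwise connected: for any two distinct points x, y ∈ X there exists a continuous map β : [0,1] → X with β(0) = x, β(1) = y, which is a topological embedding (a homeomorphism onto its image). -/
open Set Topology

/-- Two points with distinct images under a map separated by a continuous real function that
factors through the map. -/
lemma exists_continuous_separating_comp {C X : Type*} [TopologicalSpace C] [CompactSpace C]
    [TopologicalSpace X] [T2Space X] {γ : C → X} (hγ : Continuous γ) (p q : C) :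
    ∃ u : C → ℝ, Continuous u ∧ (∀ c, u c ∈ Icc (0 : ℝ) 1) ∧ (∀ a b, γ a = γ b → u a = u b) ∧
      (γ p ≠ γ q → u p = 0 ∧ u q = 1) := by
  by_cases hpq : γ p = γ q
  · exact ⟨fun _ ↦ 0, continuous_const, by simp, by simp, fun h ↦ absurd hpq h⟩
  · have : CompactSpace (range γ) := isCompact_iff_compactSpace.mp (isCompact_range hγ)
    obtain ⟨f, hf0, hf1, hf⟩ := exists_continuous_zero_one_of_isClosed
      (isClosed_singleton (x := (⟨γ p, p, rfl⟩ : range γ)))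
      (isClosed_singleton (x := (⟨γ q, q, rfl⟩ : range γ)))
      (disjoint_singleton.2 fun h ↦ hpq (congrArg Subtype.val h))
    refine ⟨fun c ↦ f ⟨γ c, c, rfl⟩, f.continuous.comp (hγ.subtype_mk _), fun c ↦ hf _,
      fun a b hab ↦ by simp only [hab], fun _ ↦ ⟨hf0 rfl, hf1 rfl⟩⟩

section Order

variable {C X : Type*} [LinearOrder C] [TopologicalSpace C] [OrderClosedTopology C]
  [CompactSpace C] [TopologicalSpace X] [T2Space X] {γ : C → X}

/-- A monotone continuous function factoring through `γ` and increasing strictly across `[p, q]`,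
obtained as a running supremum. -/
lemma exists_monotone_of_ne (hγ : Continuous γ)
    (hgap : ∀ s t, s < t → (γ s = γ t ↔ Ioo s t = ∅)) (p q : C) :
    ∃ h : C → ℝ, Continuous h ∧ Monotone h ∧ (∀ c, h c ∈ Icc (0 : ℝ) 1) ∧
      (∀ a b, γ a = γ b → h a = h b) ∧
      (γ p ≠ γ q → ∀ s t, s ≤ p → p ≤ q → q ≤ t → h s < h t) := by
  obtain ⟨u, hu, hu01, hfac, hsep⟩ := exists_continuous_separating_comp hγ p q
  have : Nonempty C := ⟨p⟩
  let F : C → C → ℝ := fun t r ↦ u (max (min r t) p)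
  have hF : Continuous ↿F := by
    change Continuous fun x : C × C ↦ u (max (min x.2 x.1) p)
    fun_prop
  have hbdd : ∀ t, BddAbove (F t '' univ) := fun t ↦
    ⟨1, by rintro _ ⟨r, -, rfl⟩; exact (hu01 _).2⟩
  have hne : ∀ t, (F t '' univ).Nonempty := fun t ↦ univ_nonempty.image _
  have hle : ∀ t r, F t r ≤ sSup (F t '' univ) := fun t r ↦
    le_csSup (hbdd t) (mem_image_of_mem _ (mem_univ r))
  have hconst : ∀ s t, s < t → γ s = γ t → F s = F t := by
    intro s t hst h
    have hempty := (hgap s t hst).1 h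
    funext r
    apply hfac
    have hr : ∀ r, r ≤ s ∨ t ≤ r := fun r ↦ by
      by_contra! hr
      exact (hempty ▸ (⟨hr.1, hr.2⟩ : r ∈ Ioo s t) : r ∈ (∅ : Set C))
    rcases hr r with h1 | h1
    · rw [min_eq_left h1, min_eq_left (h1.trans hst.le)]
    · rw [min_eq_right h1, min_eq_right (hst.le.trans h1)]
      rcases hr p with h2 | h2
      · rw [max_eq_left h2, max_eq_left (h2.trans hst.le), h]
      · rw [max_eq_right h2, max_eq_right (hst.le.trans h2)]
  refine ⟨fun t ↦ sSup (F t '' univ), isCompact_univ.continuous_sSup hF, ?_, ?_, ?_, ?_⟩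
  · intro s t hst
    apply csSup_le (hne s)
    rintro _ ⟨r, -, rfl⟩
    refine le_trans (le_of_eq ?_) (hle t (min r s))
    simp only [F, min_assoc, min_eq_left hst]
  · intro t
    exact ⟨(hu01 _).1.trans (hle t t), csSup_le (hne t) (by rintro _ ⟨r, -, rfl⟩; exact (hu01 _).2)⟩
  · intro a b hab
    dsimp only
    rcases lt_trichotomy a b with h | h | h
    · rw [hconst a b h hab]
    · rw [h]
    · rw [hconst b a h hab.symm]
  · intro hpq s t hsp hpq' hqt
    obtain ⟨h0, h1⟩ := hsep hpq
    have hs : sSup (F s '' univ) ≤ 0 := by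
      apply csSup_le (hne s)
      rintro _ ⟨r, -, rfl⟩
      simp only [F]
      rw [max_eq_right ((min_le_right r s).trans hsp), h0]
    have ht := hle t q
    simp only [F] at ht
    rw [min_eq_left hqt, max_eq_left hpq', h1] at ht
    exact lt_of_le_of_lt hs (zero_lt_one.trans_le ht)

omit [CompactSpace C] in
/-- Points of a dense set separating two points on which `γ` differs. -/
lemma exists_dense_pair_ne (hγ : Continuous γ)
    (hgap : ∀ s t, s < t → (γ s = γ t ↔ Ioo s t = ∅)) {D : Set C} (hD : Dense D) {s t : C}
    (hst : s < t) (hne : γ s ≠ γ t) :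
    ∃ p ∈ D, ∃ q ∈ D, s ≤ p ∧ p ≤ q ∧ q ≤ t ∧ γ p ≠ γ q := by
  have hopen : ∀ a b c : C, IsOpen (Ioo a b ∩ {x | γ x ≠ γ c}) := fun a b c ↦
    isOpen_Ioo.inter (isOpen_ne_fun hγ continuous_const)
  have hright : (Ioo s t ∩ {x | γ x ≠ γ t}).Nonempty := by
    by_contra hcon
    have hall : ∀ x, s < x → x < t → γ x = γ t := fun x h1 h2 ↦ by
      by_contra h
      exact hcon ⟨x, ⟨h1, h2⟩, h⟩
    obtain ⟨x, hx⟩ := nonempty_iff_ne_empty.2 (mt (hgap s t hst).2 hne)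
    rcases (Ioo s x).eq_empty_or_nonempty with he | ⟨y, hy⟩
    · exact hne (((hgap s x hx.1).2 he).trans (hall x hx.1 hx.2))
    · exact notMem_empty x ((hgap y t (hy.2.trans hx.2)).1
        (hall y hy.1 (hy.2.trans hx.2)) ▸ ⟨hy.2, hx.2⟩)
  obtain ⟨p, ⟨⟨hsp, hpt⟩, hpne⟩, hpD⟩ := hD.inter_open_nonempty _ (hopen s t t) hright
  have hleft : (Ioo p t ∩ {x | γ x ≠ γ p}).Nonempty := by
    by_contra hcon
    have hall : ∀ x, p < x → x < t → γ x = γ p := fun x h1 h2 ↦ by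
      by_contra h
      exact hcon ⟨x, ⟨h1, h2⟩, h⟩
    obtain ⟨x, hx⟩ := nonempty_iff_ne_empty.2 (mt (hgap p t hpt).2 hpne)
    rcases (Ioo x t).eq_empty_or_nonempty with he | ⟨y, hy⟩
    · exact hpne ((hall x hx.1 hx.2).symm.trans ((hgap x t hx.2).2 he))
    · exact notMem_empty x ((hgap p y (hx.1.trans hy.1)).1
        (hall y (hx.1.trans hy.1) hy.2).symm ▸ ⟨hx.1, hy.1⟩)
  obtain ⟨q, ⟨⟨hpq, hqt⟩, hqne⟩, hqD⟩ := hD.inter_open_nonempty _ (hopen p t p) hleft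
  exact ⟨p, hpD, q, hqD, hsp.le, hpq.le, hqt.le, fun h ↦ hqne h.symm⟩

/-- If `γ` identifies exactly the endpoints of the gaps of `C`, then its fibers are the fibers of a
monotone continuous real function. -/
lemma exists_monotone_fiber_eq [TopologicalSpace.SeparableSpace C] [Nonempty C]
    (hγ : Continuous γ) (hgap : ∀ s t, s < t → (γ s = γ t ↔ Ioo s t = ∅)) :
    ∃ g : C → ℝ, Continuous g ∧ Monotone g ∧ ∀ a b, g a = g b ↔ γ a = γ b := by
  let d := TopologicalSpace.denseSeq C
  choose h hcont hmono h01 hfac hlt using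
    fun i : ℕ × ℕ ↦ exists_monotone_of_ne hγ hgap (d i.1) (d i.2)
  obtain ⟨w, hw, c, hc, -⟩ := posSumOfEncodable (zero_lt_one (α := ℝ)) (ℕ × ℕ)
  have hnorm : ∀ i x, ‖w i * h i x‖ ≤ w i := fun i x ↦ by
    rw [Real.norm_of_nonneg (mul_nonneg (hw i).le (h01 i x).1)]
    exact mul_le_of_le_one_right (hw i).le (h01 i x).2
  have hsum : ∀ x, Summable fun i ↦ w i * h i x := fun x ↦
    Summable.of_norm_bounded hc.summable (hnorm · x)
  have hm : ∀ i, Monotone fun x ↦ w i * h i x := fun i x y hxy ↦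
    mul_le_mul_of_nonneg_left (hmono i hxy) (hw i).le
  have hstrict : ∀ a b, a < b → γ a ≠ γ b → ∑' i, w i * h i a < ∑' i, w i * h i b := by
    intro a b hab hne
    obtain ⟨_, ⟨m, rfl⟩, _, ⟨n, rfl⟩, h1, h2, h3, h4⟩ :=
      exists_dense_pair_ne hγ hgap (TopologicalSpace.denseRange_denseSeq C) hab hne
    exact (hsum a).tsum_lt_tsum (fun i ↦ hm i hab.le)
      (mul_lt_mul_of_pos_left (hlt (m, n) h4 a b h1 h2 h3) (hw _)) (hsum b)
  refine ⟨fun x ↦ ∑' i, w i * h i x, ?_, ?_, ?_⟩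
  · exact continuous_tsum (fun i ↦ continuous_const.mul (hcont i)) hc.summable hnorm
  · exact fun x y hxy ↦ (hsum x).tsum_le_tsum (fun i ↦ hm i hxy) (hsum y)
  · refine fun a b ↦ ⟨fun hab ↦ ?_, fun hab ↦ ?_⟩
    · by_contra hne
      rcases lt_trichotomy a b with hlt | heq | hlt
      · exact (hstrict a b hlt hne).ne hab
      · exact hne (congrArg γ heq)
      · exact (hstrict b a hlt (Ne.symm hne)).ne hab.symm
    · exact tsum_congr fun i ↦ by rw [hfac i a b hab]

/-- A path parametrized by a compact separable linear order that identifies exactly the endpoints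
of gaps has an arc as its image. -/
lemma exists_arc_of_gap [TopologicalSpace.SeparableSpace C] [BoundedOrder C]
    (hγ : Continuous γ) (hgap : ∀ s t, s < t → (γ s = γ t ↔ Ioo s t = ∅)) (hne : γ ⊥ ≠ γ ⊤) :
    ∃ β : unitInterval → X, Continuous β ∧ β 0 = γ ⊥ ∧ β 1 = γ ⊤ ∧ IsEmbedding β := by
  obtain ⟨g, hg, hmono, hfib⟩ := exists_monotone_fiber_eq hγ hgap
  have hlt : 0 < g ⊤ - g ⊥ :=
    sub_pos.2 (lt_of_le_of_ne (hmono bot_le) (mt (hfib _ _).1 hne))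
  let G : C → unitInterval := fun c ↦ ⟨(g c - g ⊥) / (g ⊤ - g ⊥),
    div_nonneg (sub_nonneg.2 (hmono bot_le)) hlt.le,
    (div_le_one hlt).2 (sub_le_sub_right (hmono le_top) _)⟩
  have hG : Continuous G := by
    refine Continuous.subtype_mk ?_ _
    fun_prop
  have hGfib : ∀ a b, G a = G b ↔ γ a = γ b := fun a b ↦ by
    rw [← hfib, Subtype.ext_iff, div_left_inj' hlt.ne', sub_left_inj]
  have hGmono : Monotone G := fun a b hab ↦
    div_le_div_of_nonneg_right (sub_le_sub_right (hmono hab) _) hlt.le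
  have hG0 : G ⊥ = 0 := Subtype.ext (by simp [G])
  have hG1 : G ⊤ = 1 := Subtype.ext (by simp [G, hlt.ne'])
  have hsurj : Function.Surjective G := by
    intro z
    obtain ⟨a, ha, hamax⟩ := (isClosed_le hG continuous_const).isCompact.exists_isGreatest
      (⟨⊥, hG0.trans_le bot_le⟩ : {c | G c ≤ z}.Nonempty)
    obtain ⟨b, hb, hbmin⟩ := (isClosed_le continuous_const hG).isCompact.exists_isLeast
      (⟨⊤, le_top.trans_eq hG1.symm⟩ : {c | z ≤ G c}.Nonempty)
    by_contra! hz
    have haz : G a < z := lt_of_le_of_ne ha (hz a)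
    have hzb : z < G b := lt_of_le_of_ne hb (hz b).symm
    have hab : a < b := hGmono.reflect_lt (haz.trans hzb)
    refine (haz.trans hzb).ne ((hGfib a b).2 ((hgap a b hab).2 ?_))
    refine eq_empty_of_forall_notMem fun c hc ↦ ?_
    rcases le_total (G c) z with h | h
    · exact (hamax h).not_gt hc.1
    · exact (hbmin h).not_gt hc.2
  have hquot : IsQuotientMap G := IsQuotientMap.of_surjective_continuous hsurj hG
  let β : unitInterval → X := γ ∘ Function.surjInv hsurj
  have hβG : ∀ c, β (G c) = γ c := fun c ↦
    (hGfib _ _).1 (Function.surjInv_eq hsurj (G c))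
  have hβ : Continuous β := hquot.continuous_iff.2 (by rwa [show β ∘ G = γ from funext hβG])
  have hinj : Function.Injective β := by
    intro y z hyz
    obtain ⟨a, rfl⟩ := hsurj y
    obtain ⟨b, rfl⟩ := hsurj z
    rw [hβG, hβG] at hyz
    exact (hGfib a b).2 hyz
  exact ⟨β, hβ, by rw [← hG0, hβG], by rw [← hG1, hβG], (hβ.isClosedEmbedding hinj).isEmbedding⟩

end Order

/-- The closed subsets of the unit interval obtained by deleting loops of the path `α`: they contain
both endpoints, and `α` agrees at the two ends of each gap. -/
def loopErasures {X : Type*} (α : unitInterval → X) : Set (Set unitInterval) :=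
  {C | IsClosed C ∧ 0 ∈ C ∧ 1 ∈ C ∧
    ∀ a ∈ C, ∀ b ∈ C, a < b → Ioo a b ∩ C = ∅ → α a = α b}

/-- Loop erasures are stable under intersections of nonempty chains. -/
lemma sInter_mem_loopErasures {X : Type*} [TopologicalSpace X] [T2Space X] {α : unitInterval → X}
    (hα : Continuous α) {c : Set (Set unitInterval)} (hc : c ⊆ loopErasures α)
    (hchain : IsChain (· ⊆ ·) c) (hne : c.Nonempty) : ⋂₀ c ∈ loopErasures α := by
  refine ⟨isClosed_sInter fun C hC ↦ (hc hC).1, fun C hC ↦ (hc hC).2.1,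
    fun C hC ↦ (hc hC).2.2.1, fun a ha b hb hab hgap ↦ ?_⟩
  by_contra hab'
  obtain ⟨U, V, hU, hV, haU, hbV, hUV⟩ := t2_separation hab'
  obtain ⟨m, ham, hmb⟩ := exists_between hab
  obtain ⟨a', ⟨haa', ha'm⟩, ha'U⟩ := (mem_nhdsGE_iff_exists_mem_Ioc_Ico_subset ham).1
    (mem_nhdsWithin_of_mem_nhds ((hU.preimage hα).mem_nhds haU))
  obtain ⟨b', ⟨hmb', hb'b⟩, hb'V⟩ := (mem_nhdsLE_iff_exists_mem_Ico_Ioc_subset hmb).1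
    (mem_nhdsWithin_of_mem_nhds ((hV.preimage hα).mem_nhds hbV))
  obtain ⟨a₁, haa₁, ha₁⟩ := exists_between haa'
  obtain ⟨b₁, hb₁, hb₁b⟩ := exists_between hb'b
  have hab₁ : a₁ < b₁ := ha₁.trans (ha'm.trans_lt (hmb'.trans_lt hb₁))
  obtain ⟨C, hC, hdisj⟩ : ∃ C ∈ c, Icc a₁ b₁ ∩ C = ∅ := by
    have : Nonempty c := hne.to_subtype
    by_contra! hcon
    obtain ⟨x, hx⟩ := IsCompact.nonempty_iInter_of_directed_nonempty_isCompact_isClosed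
      (fun C : c ↦ Icc a₁ b₁ ∩ C.1)
      (fun C D ↦ by
        rcases hchain.total C.2 D.2 with h | h
        · exact ⟨C, subset_rfl, inter_subset_inter_right _ h⟩
        · exact ⟨D, inter_subset_inter_right _ h, subset_rfl⟩)
      (fun C ↦ hcon C.1 C.2)
      (fun C ↦ isCompact_Icc.inter_right (hc C.2).1)
      (fun C ↦ isClosed_Icc.inter (hc C.2).1)
    rw [mem_iInter] at hx
    have hxI := (hx ⟨hne.some, hne.some_mem⟩).1
    exact notMem_empty x (hgap ▸ ⟨⟨haa₁.trans_le hxI.1, hxI.2.trans_lt hb₁b⟩,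
      fun D hD ↦ (hx ⟨D, hD⟩).2⟩)
  obtain ⟨hCcl, -, -, hCgap⟩ := hc hC
  obtain ⟨s, ⟨hsC, hsa⟩, hsmax⟩ := (hCcl.inter isClosed_Iic).isCompact.exists_isGreatest
    (⟨a, ha C hC, haa₁.le⟩ : (C ∩ Iic a₁).Nonempty)
  obtain ⟨t, ⟨htC, hbt⟩, htmin⟩ := (hCcl.inter isClosed_Ici).isCompact.exists_isLeast
    (⟨b, hb C hC, hb₁b.le⟩ : (C ∩ Ici b₁).Nonempty)
  have has : a ≤ s := hsmax ⟨ha C hC, haa₁.le⟩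
  have htb : t ≤ b := htmin ⟨hb C hC, hb₁b.le⟩
  have hst : α s = α t := by
    refine hCgap s hsC t htC (hsa.trans_lt (hab₁.trans_le hbt)) ?_
    refine eq_empty_of_forall_notMem fun x hx ↦ ?_
    rcases le_or_gt x a₁ with h | h
    · exact (hsmax ⟨hx.2, h⟩).not_gt hx.1.1
    · rcases le_or_gt b₁ x with h' | h'
      · exact (htmin ⟨hx.2, h'⟩).not_gt hx.1.2
      · exact notMem_empty x (hdisj ▸ ⟨⟨h.le, h'.le⟩, hx.2⟩)
  exact disjoint_left.1 hUV (ha'U ⟨has, hsa.trans_lt ha₁⟩)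
    (hst ▸ hb'V ⟨hb₁.trans_le hbt, htb⟩)

/-- A minimal loop erasure meets no open interval whose endpoints lie in it and have the same
image. -/
lemma exists_minimal_loopErasure {X : Type*} [TopologicalSpace X] [T2Space X]
    {α : unitInterval → X} (hα : Continuous α) :
    ∃ C ∈ loopErasures α, ∀ a ∈ C, ∀ b ∈ C, a < b → (α a = α b ↔ Ioo a b ∩ C = ∅) := by
  obtain ⟨C, hC⟩ := zorn_superset (loopErasures α) fun c hc hchain ↦ by
    rcases c.eq_empty_or_nonempty with rfl | hne
    · refine ⟨univ, ⟨isClosed_univ, mem_univ _, mem_univ _, fun a _ b _ hab h ↦ ?_⟩, by simp⟩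
      rw [inter_univ] at h
      exact absurd h (nonempty_Ioo.2 hab).ne_empty
    · exact ⟨⋂₀ c, sInter_mem_loopErasures hα hc hchain hne, fun s hs ↦ sInter_subset_of_mem hs⟩
  obtain ⟨hcl, h0, h1, hgap⟩ := hC.prop
  refine ⟨C, hC.prop, fun a ha b hb hab ↦ ⟨fun heq ↦ ?_, hgap a ha b hb hab⟩⟩
  have hmem : C \ Ioo a b ∈ loopErasures α := by
    refine ⟨hcl.sdiff isOpen_Ioo, ⟨h0, fun h ↦ h.1.not_ge bot_le⟩,
      ⟨h1, fun h ↦ h.2.not_ge le_top⟩, fun s hs t ht hst hempty ↦ ?_⟩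
    have hnot : ∀ x ∈ C, x ∉ Ioo a b → s < x → x < t → False := fun x hx hx' h h' ↦
      notMem_empty x (hempty ▸ ⟨⟨h, h'⟩, hx, hx'⟩)
    by_cases hx : (Ioo s t ∩ C).Nonempty
    · obtain ⟨x, hxst, hxC⟩ := hx
      have hxab : x ∈ Ioo a b := by
        by_contra h
        exact hnot x hxC h hxst.1 hxst.2
      have hsa : s = a := by
        rcases lt_trichotomy s a with h | h | h
        · exact (hnot a ha (fun h ↦ h.1.false) h (hxab.1.trans hxst.2)).elim
        · exact h
        · exact (hs.2 ⟨h, hxst.1.trans hxab.2⟩).elim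
      have htb : t = b := by
        rcases lt_trichotomy t b with h | h | h
        · exact (ht.2 ⟨hxab.1.trans hxst.2, h⟩).elim
        · exact h
        · exact (hnot b hb (fun h ↦ h.2.false) (hxst.1.trans hxab.2) h).elim
      rw [hsa, htb, heq]
    · exact hgap s hs.1 t ht.1 hst (not_nonempty_iff_eq_empty.1 hx)
  exact eq_empty_of_forall_notMem fun x hx ↦ (hC.le_of_le hmem sdiff_subset hx.2).2 hx.1

/-- Every path-connected Hausdorff space is arcwise connected. -/
theorem path_connected_hausdorff_arcwise_connected
    {X : Type*} [TopologicalSpace X] [T2Space X]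
    (hpc : ∀ x y : X, ∃ α : unitInterval → X, Continuous α ∧ α 0 = x ∧ α 1 = y) :
    ∀ x y : X, x ≠ y →
      ∃ β : unitInterval → X, Continuous β ∧ β 0 = x ∧ β 1 = y ∧
        Topology.IsEmbedding β := by
  intro x y hxy
  obtain ⟨α, hα, rfl, rfl⟩ := hpc x y
  obtain ⟨C, ⟨hcl, h0, h1, -⟩, hgap⟩ := exists_minimal_loopErasure hα
  have : CompactSpace C := isCompact_iff_compactSpace.mp hcl.isCompact
  let : BoundedOrder C :=
    { bot := ⟨0, h0⟩
      bot_le := fun c ↦ c.1.2.1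
      top := ⟨1, h1⟩
      le_top := fun c ↦ c.1.2.2 }
  refine exists_arc_of_gap (γ := fun c : C ↦ α c) (hα.comp continuous_subtype_val)
    (fun s t hst ↦ (hgap s s.2 t t.2 hst).trans ?_) hxy
  simp only [eq_empty_iff_forall_notMem]
  exact ⟨fun h z hz ↦ h z ⟨hz, z.2⟩, fun h z hz ↦ h ⟨z, hz.2⟩ hz.1⟩
end

section
/- Let X be a space that permits loop deletion and let α, β : [0,1] → X be continuous maps such that α(1/n) = β(1/n) for all n ∈ ℕ with n ≥ 1. Then α(0) = β(0). -/
/-- A space `X` permits loop deletion if for every path `α : [0,1] → X` and all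
sequences `(aₙ)` nonincreasing to `0` and `(bₙ)` nondecreasing to `1` with
`a₀ < b₀` and `α (aₙ) = α (bₙ)` for all `n`, one has `α 0 = α 1`. -/
def PermitsLoopDeletion (X : Type*) [TopologicalSpace X] : Prop :=
  ∀ α : unitInterval → X, Continuous α →
    ∀ a b : ℕ → unitInterval, Antitone a → Monotone b → a 0 < b 0 →
      Filter.Tendsto a Filter.atTop (nhds 0) →
      Filter.Tendsto b Filter.atTop (nhds 1) →
      (∀ n : ℕ, α (a n) = α (b n)) → α 0 = α 1

/-- If `X` permits loop deletion and two paths `α, β` satisfy `α(1/n) = β(1/n)`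
for all `n ≥ 1`, then `α 0 = β 0`. -/
theorem eq_at_zero_of_permitsLoopDeletion
    {X : Type*} [TopologicalSpace X] (hX : PermitsLoopDeletion X)
    (α β : unitInterval → X) (hα : Continuous α) (hβ : Continuous β)
    (heq : ∀ n : ℕ, 1 ≤ n → ∀ t : unitInterval, (t : ℝ) = 1 / n → α t = β t) :
    α 0 = β 0 := by
  -- Follow `α` on the first half and `β` backwards on the second half.
  let γ : unitInterval → X := fun t =>
    if (t : ℝ) ≤ 1 / 2 then α (Set.projIcc 0 1 zero_le_one (2 * (t : ℝ)))
    else β (Set.projIcc 0 1 zero_le_one (2 - 2 * (t : ℝ)))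
  have hγ : Continuous γ := by
    refine Continuous.if_le (hα.comp (continuous_projIcc.comp (by fun_prop)))
      (hβ.comp (continuous_projIcc.comp (by fun_prop))) (by fun_prop) (by fun_prop) ?_
    intro t ht
    have h1 : 2 * (t : ℝ) = 1 := by rw [ht]; norm_num
    have h2 : 2 - 2 * (t : ℝ) = 1 := by rw [ht]; norm_num
    change α (Set.projIcc 0 1 zero_le_one (2 * (t : ℝ))) =
      β (Set.projIcc 0 1 zero_le_one (2 - 2 * (t : ℝ)))
    rw [h2, h1, Set.projIcc_right]
    exact heq 1 le_rfl _ (by simp)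
  have hmem : ∀ n : ℕ, (1 / 2 * (1 / ((n : ℝ) + 2))) ∈ Set.Icc (0 : ℝ) (1 / 4) := by
    intro n
    have h : 1 / ((n : ℝ) + 2) ≤ 1 / 2 := by gcongr; linarith [n.cast_nonneg (α := ℝ)]
    exact ⟨by positivity, by linarith⟩
  let a : ℕ → unitInterval := fun n =>
    ⟨1 / 2 * (1 / ((n : ℝ) + 2)), (hmem n).1, by linarith [(hmem n).2]⟩
  have ha : Antitone a := by
    intro m n hmn
    change (1 / 2 * (1 / ((n : ℝ) + 2))) ≤ 1 / 2 * (1 / ((m : ℝ) + 2))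
    gcongr
  have hlim : Filter.Tendsto a Filter.atTop (nhds 0) := by
    rw [tendsto_subtype_rng]
    have h := ((tendsto_one_div_add_atTop_nhds_zero_nat (𝕜 := ℝ)).comp
      (Filter.tendsto_add_atTop_nat 1)).const_mul (1 / 2 : ℝ)
    rw [mul_zero] at h
    refine h.congr fun n => ?_
    simp only [a, Function.comp_apply]
    push_cast
    ring
  have key := hX γ hγ a (fun n => unitInterval.symm (a n)) ha
    (fun m n hmn => unitInterval.symm_le_symm.mpr (ha hmn)) ?_ hlim ?_ ?_
  · have h0 : γ 0 = α 0 := by simp [γ]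
    have h1 : γ 1 = β 0 := by norm_num [γ]
    rwa [h0, h1] at key
  · change (1 / 2 * (1 / (((0 : ℕ) : ℝ) + 2))) < 1 - 1 / 2 * (1 / (((0 : ℕ) : ℝ) + 2))
    norm_num
  · simpa [Function.comp_def] using (unitInterval.continuous_symm.tendsto 0).comp hlim
  · intro n
    obtain ⟨hn0, hn1⟩ := hmem n
    have hsymm : ((unitInterval.symm (a n) : unitInterval) : ℝ) = 1 - (a n : ℝ) := rfl
    have hval : (a n : ℝ) = 1 / 2 * (1 / ((n : ℝ) + 2)) := rfl
    have hleft : (a n : ℝ) ≤ 1 / 2 := by linarith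
    have hright : ¬ (1 - (a n : ℝ) ≤ 1 / 2) := by linarith
    have hback : 2 - 2 * (1 - (a n : ℝ)) = 2 * (a n : ℝ) := by ring
    simp only [γ, hsymm, if_pos hleft, if_neg hright, hback]
    refine heq (n + 2) (by omega) _ ?_
    rw [Set.projIcc_of_mem zero_le_one (x := 2 * (a n : ℝ)) ⟨by linarith, by linarith⟩]
    change 2 * (a n : ℝ) = _
    rw [hval]
    push_cast
    ring
end

section
/- Let α : [0,1] → X be a continuous map with α(0) ≠ α(1), and let 𝒰 be a loop-cancellation of α that is maximal in the partial order on loop-cancellations of α. Then 𝒰 is collapsible: the closures of the elements of 𝒰 are pairwise disjoint (and 𝒰 ≠ {(0,1)}). -/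
/-- A loop-cancellation of a path `α : [0,1] → X`: a set of pairwise-disjoint
open intervals `(a,b) ⊆ [0,1]` (encoded by their endpoint pairs) such that
`α a = α b` for each interval. -/
def IsLoopCancellation {X : Type*} (α : ℝ → X) (U : Set (ℝ × ℝ)) : Prop :=
  (∀ p ∈ U, 0 ≤ p.1 ∧ p.1 < p.2 ∧ p.2 ≤ 1 ∧ α p.1 = α p.2) ∧
  U.Pairwise fun p q => Disjoint (Set.Ioo p.1 p.2) (Set.Ioo q.1 q.2)

/-- The partial order on loop-cancellations: `U ≤ V` iff every interval of `U`
is contained in some interval of `V`. -/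
def LCle (U V : Set (ℝ × ℝ)) : Prop :=
  ∀ p ∈ U, ∃ q ∈ V, Set.Ioo p.1 p.2 ⊆ Set.Ioo q.1 q.2

/-- `U` is a maximal loop-cancellation of `α`: any loop-cancellation above it
is also below it (hence equal to it). -/
def IsMaximalLoopCancellation {X : Type*} (α : ℝ → X) (U : Set (ℝ × ℝ)) : Prop :=
  IsLoopCancellation α U ∧
    ∀ V : Set (ℝ × ℝ), IsLoopCancellation α V → LCle U V → LCle V U

/-- Distinct intervals of a maximal loop-cancellation share no endpoint. -/
theorem IsMaximalLoopCancellation.snd_ne_fst {X : Type*} {α : ℝ → X} {U : Set (ℝ × ℝ)}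
    (hU : IsMaximalLoopCancellation α U) {p q : ℝ × ℝ} (hp : p ∈ U) (hq : q ∈ U) :
    p.2 ≠ q.1 := by
  intro h
  obtain ⟨⟨hmem, hdisj⟩, hmax⟩ := hU
  obtain ⟨hp0, hp12, -, hpα⟩ := hmem p hp
  obtain ⟨-, hq12, hq1, hqα⟩ := hmem q hq
  have hmerge : ∀ r ∈ U, r ≠ p → r ≠ q → Disjoint (Set.Ioo p.1 q.2) (Set.Ioo r.1 r.2) := by
    intro r hr hrp hrq
    have hr12 := (hmem r hr).2.1
    have h₁ := hdisj hp hr hrp.symm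
    have h₂ := hdisj hq hr hrq.symm
    simp only [Set.Ioo_disjoint_Ioo] at h₁ h₂ ⊢
    grind
  let V : Set (ℝ × ℝ) := insert (p.1, q.2) (U \ {p, q})
  have hV : IsLoopCancellation α V := by
    refine ⟨?_, ?_⟩
    · rintro r (rfl | ⟨hr, -⟩)
      · exact ⟨hp0, by simp only; linarith, hq1, by simp only; rw [hpα, h, hqα]⟩
      · exact hmem r hr
    · refine (hdisj.mono Set.sdiff_subset).insert ?_
      rintro r ⟨hr, hr'⟩ -
      simp only [Set.mem_insert_iff, Set.mem_singleton_iff, not_or] at hr'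
      have := hmerge r hr hr'.1 hr'.2
      exact ⟨this, this.symm⟩
  have hUV : LCle U V := by
    intro r hr
    rcases eq_or_ne r p with rfl | hrp
    · exact ⟨_, Set.mem_insert _ _, Set.Ioo_subset_Ioo_right (by simp only; linarith)⟩
    rcases eq_or_ne r q with rfl | hrq
    · exact ⟨_, Set.mem_insert _ _, Set.Ioo_subset_Ioo_left (by simp only; linarith)⟩
    · exact ⟨r, Set.mem_insert_of_mem _ ⟨hr, by simp [hrp, hrq]⟩, subset_rfl⟩
  obtain ⟨s, hs, hsub⟩ := hmax V hV hUV (p.1, q.2) (Set.mem_insert _ _)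
  rw [Set.Ioo_subset_Ioo_iff (by simp only; linarith)] at hsub
  obtain ⟨hs₁, hs₂⟩ := hsub
  simp only at hs₁ hs₂
  by_cases hsp : s = p
  · subst hsp
    linarith
  · have := hdisj hs hp hsp
    simp only [Set.Ioo_disjoint_Ioo] at this
    grind

/-- A maximal loop-cancellation of a non-loop path is collapsible: it is not
`{(0,1)}` and the closures of its intervals are pairwise disjoint. -/
theorem maximal_loopCancellation_collapsible
    {X : Type*} [TopologicalSpace X] (α : ℝ → X)
    (hα : ContinuousOn α (Set.Icc 0 1)) (hne : α 0 ≠ α 1)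
    (U : Set (ℝ × ℝ)) (hU : IsMaximalLoopCancellation α U) :
    U ≠ {((0 : ℝ), (1 : ℝ))} ∧
      U.Pairwise fun p q => Disjoint (Set.Icc p.1 p.2) (Set.Icc q.1 q.2) := by
  refine ⟨?_, ?_⟩
  · rintro rfl
    exact hne (hU.1.1 (0, 1) rfl).2.2.2
  · intro p hp q hq hpq
    have hp12 := (hU.1.1 p hp).2.1
    have hq12 := (hU.1.1 q hq).2.1
    have hd := hU.1.2 hp hq hpq
    have h₁ := hU.snd_ne_fst hp hq
    have h₂ := hU.snd_ne_fst hq hp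
    simp only [Set.Ioo_disjoint_Ioo] at hd
    refine Set.disjoint_left.2 fun x hx hy => ?_
    obtain ⟨hx₁, hx₂⟩ := hx
    obtain ⟨hy₁, hy₂⟩ := hy
    grind
end

section
/- Let α : [0,1] → X be a continuous map with α(0) ≠ α(1), let 𝒰 be a loop-cancellation of α that is maximal in the partial order on loop-cancellations of α, and let Γ : [0,1] → [0,1] be a collapsing function for 𝒰. Suppose β : [0,1] → X is a continuous map such that β(Γ(t)) = α(t) for all t ∈ [0,1] \ ⋃𝒰 and, for each interval (a,b) ∈ 𝒰, β(Γ(t)) = α(a) for all t ∈ [a,b]. Then β is injective. -/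
/-- A collapsing function for a collection `U` of open intervals (encoded by
endpoint pairs): a nondecreasing continuous surjection `[0,1] → [0,1]` that is
constant on the closure of each interval of `U` and strictly increasing on the
complement of the union of these closures. -/
def IsCollapsingFunction (U : Set (ℝ × ℝ)) (Γ : ℝ → ℝ) : Prop :=
  ContinuousOn Γ (Set.Icc 0 1) ∧
  MonotoneOn Γ (Set.Icc 0 1) ∧
  Γ '' Set.Icc 0 1 = Set.Icc 0 1 ∧
  (∀ p ∈ U, ∀ s ∈ Set.Icc p.1 p.2, ∀ t ∈ Set.Icc p.1 p.2, Γ s = Γ t) ∧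
  StrictMonoOn Γ (Set.Icc 0 1 \ ⋃ p ∈ U, Set.Icc p.1 p.2)

open Set in
/-- The left endpoint of an interval of a loop-cancellation lies in no interval of it. -/
theorem IsLoopCancellation.left_notMem_iUnion {X : Type*} {α : ℝ → X} {U : Set (ℝ × ℝ)}
    (hU : IsLoopCancellation α U) {p : ℝ × ℝ} (hp : p ∈ U) :
    p.1 ∉ ⋃ q ∈ U, Ioo q.1 q.2 := by
  simp only [mem_iUnion, not_exists]
  intro q hq hpq
  have hlt := (hU.1 p hp).2.1
  have hne : p ≠ q := by
    rintro rfl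
    exact lt_irrefl _ hpq.1
  obtain ⟨m, hm, hm'⟩ := exists_between (lt_min hlt hpq.2)
  rw [lt_min_iff] at hm'
  exact disjoint_left.1 (hU.2 hp hq hne) ⟨hm, hm'.1⟩ ⟨hpq.1.trans hm, hm'.2⟩

open Set in
/-- Every value of a collapsing function is attained outside the collapsed open intervals. -/
theorem IsCollapsingFunction.exists_notMem_iUnion {X : Type*} {α : ℝ → X} {U : Set (ℝ × ℝ)}
    {Γ : ℝ → ℝ} (hΓ : IsCollapsingFunction U Γ) (hU : IsLoopCancellation α U) {x : ℝ}
    (hx : x ∈ Icc (0 : ℝ) 1) : ∃ s ∈ Icc (0 : ℝ) 1 \ ⋃ p ∈ U, Ioo p.1 p.2, Γ s = x := by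
  obtain ⟨-, -, himg, hconst, -⟩ := hΓ
  obtain ⟨s, hs, rfl⟩ : x ∈ Γ '' Icc 0 1 := himg.symm.subset hx
  by_cases h : s ∈ ⋃ p ∈ U, Ioo p.1 p.2
  · obtain ⟨p, hp, hsp⟩ := mem_iUnion₂.1 h
    obtain ⟨h0, hlt, h1, -⟩ := hU.1 p hp
    exact ⟨p.1, ⟨⟨h0, hlt.le.trans h1⟩, hU.left_notMem_iUnion hp⟩,
      hconst p hp _ (left_mem_Icc.2 hlt.le) _ (Ioo_subset_Icc_self hsp)⟩
  · exact ⟨s, ⟨hs, h⟩, rfl⟩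

open Set in
/-- Two points outside the intervals of a maximal loop-cancellation with the same image bound
a subinterval of one of its intervals. -/
theorem IsMaximalLoopCancellation.exists_Ioo_subset {X : Type*} {α : ℝ → X} {U : Set (ℝ × ℝ)}
    (hU : IsMaximalLoopCancellation α U) {s t : ℝ}
    (hs : s ∈ Icc (0 : ℝ) 1 \ ⋃ p ∈ U, Ioo p.1 p.2)
    (ht : t ∈ Icc (0 : ℝ) 1 \ ⋃ p ∈ U, Ioo p.1 p.2) (hst : s < t) (hα : α s = α t) :
    ∃ q ∈ U, Ioo s t ⊆ Ioo q.1 q.2 := by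
  obtain ⟨⟨hmem, hdisj⟩, hmax⟩ := hU
  refine hmax (insert (s, t) {p ∈ U | Disjoint (Ioo p.1 p.2) (Ioo s t)}) ⟨?_, ?_⟩ ?_
    (s, t) (mem_insert _ _)
  · rintro p (rfl | hp)
    · exact ⟨hs.1.1, hst, ht.1.2, hα⟩
    · exact hmem p hp.1
  · rintro p (rfl | hp) q (rfl | hq) hpq
    · exact absurd rfl hpq
    · exact hq.2.symm
    · exact hp.2
    · exact hdisj hp.1 hq.1 hpq
  · intro p hp
    by_cases h : Disjoint (Ioo p.1 p.2) (Ioo s t)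
    · exact ⟨p, mem_insert_of_mem _ ⟨hp, h⟩, Subset.rfl⟩
    · obtain ⟨m, hm, hm'⟩ := not_disjoint_iff.1 h
      refine ⟨(s, t), mem_insert _ _, Ioo_subset_Ioo ?_ ?_⟩
      · by_contra! hlt
        exact hs.2 (mem_iUnion₂.2 ⟨p, hp, hlt, hm'.1.trans hm.2⟩)
      · by_contra! hlt
        exact ht.2 (mem_iUnion₂.2 ⟨p, hp, hm.1.trans hm'.2, hlt⟩)

/-- A reduction of `α` by a maximal loop-cancellation is injective. -/
theorem reduction_injective
    {X : Type*} [TopologicalSpace X] (α β : ℝ → X) (Γ : ℝ → ℝ)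
    (hα : ContinuousOn α (Set.Icc 0 1)) (hβ : ContinuousOn β (Set.Icc 0 1))
    (hne : α 0 ≠ α 1)
    (U : Set (ℝ × ℝ)) (hU : IsMaximalLoopCancellation α U)
    (hΓ : IsCollapsingFunction U Γ)
    (hβΓ : ∀ t ∈ Set.Icc (0 : ℝ) 1 \ ⋃ p ∈ U, Set.Ioo p.1 p.2, β (Γ t) = α t)
    (hβconst : ∀ p ∈ U, ∀ t ∈ Set.Icc p.1 p.2, β (Γ t) = α p.1) :
    Set.InjOn β (Set.Icc 0 1) := by
  have key : ∀ x ∈ Set.Icc (0 : ℝ) 1, ∀ y ∈ Set.Icc (0 : ℝ) 1, x < y → β x ≠ β y := by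
    intro x hx y hy hxy hβxy
    obtain ⟨s, hs, rfl⟩ := hΓ.exists_notMem_iUnion hU.1 hx
    obtain ⟨t, ht, rfl⟩ := hΓ.exists_notMem_iUnion hU.1 hy
    have hst : s < t := hΓ.2.1.reflect_lt hs.1 ht.1 hxy
    rw [hβΓ s hs, hβΓ t ht] at hβxy
    obtain ⟨q, hq, hsub⟩ := hU.exists_Ioo_subset hs ht hst hβxy
    obtain ⟨h1, h2⟩ := (Set.Ioo_subset_Ioo_iff hst).1 hsub
    exact hxy.ne (hΓ.2.2.2.1 q hq s ⟨h1, hst.le.trans h2⟩ t ⟨h1.trans hst.le, h2⟩)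
  intro x hx y hy hxy
  by_contra hne'
  rcases lt_or_gt_of_ne hne' with h | h
  · exact key x hx y hy h hxy
  · exact key y hy x hx h hxy.symm
end

section
/- Every Δ-Hausdorff topological space permits loop deletion: if X is Δ-Hausdorff, α : [0,1] → X is continuous, and (aₙ), (bₙ) are sequences in [0,1] with 0 ≤ ⋯ ≤ a₂ ≤ a₁ < b₁ ≤ b₂ ≤ ⋯ ≤ 1, aₙ → 0, bₙ → 1, and α(aₙ) = α(bₙ) for all n ∈ ℕ, then α(0) = α(1). -/
/-- A space `X` is Δ-Hausdorff if the image of every path `[0,1] → X` is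
closed in `X`. -/
def DeltaHausdorff (X : Type*) [TopologicalSpace X] : Prop :=
  ∀ α : unitInterval → X, Continuous α → IsClosed (Set.range α)

/-- Every Δ-Hausdorff space permits loop deletion. -/
theorem deltaHausdorff_permits_loop_deletion
    {X : Type*} [TopologicalSpace X] (hX : DeltaHausdorff X)
    (α : unitInterval → X) (hα : Continuous α)
    (a b : ℕ → unitInterval)
    (ha_anti : Antitone a) (hb_mono : Monotone b)
    (hab : a 0 < b 0)
    (ha_lim : Filter.Tendsto a Filter.atTop (nhds 0))
    (hb_lim : Filter.Tendsto b Filter.atTop (nhds 1))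
    (heq : ∀ n : ℕ, α (a n) = α (b n)) :
    α 0 = α 1 := by
  have mem_range_initial : ∀ n, ∃ t, α (min t (a n)) = α 1 := fun n =>
    (hX (fun t => α (min t (a n))) (by fun_prop)).mem_of_tendsto
      ((hα.tendsto 1).comp hb_lim)
      (Filter.eventually_atTop.2 ⟨n, fun m hm =>
        ⟨a m, by simp only [Function.comp_apply, min_eq_left (ha_anti hm), heq m]⟩⟩)
  choose t ht using mem_range_initial
  have isClosed_point : IsClosed {α 1} := by
    simpa only [Set.range_const] using hX (fun _ => α 1) continuous_const
  have tendsto_zero : Filter.Tendsto (fun n => min (t n) (a n)) Filter.atTop (nhds 0) :=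
    tendsto_of_tendsto_of_tendsto_of_le_of_le tendsto_const_nhds ha_lim
      (fun _ => unitInterval.nonneg') (fun _ => min_le_right _ _)
  exact (isClosed_point.preimage hα).mem_of_tendsto tendsto_zero (Filter.Eventually.of_forall ht)
end

section
/- Let X be a Δ-Hausdorff topological space and let α : [0,1] → X be a continuous injective map. Then α is a closed embedding: α is a homeomorphism onto its image and α maps closed subsets of [0,1] to closed subsets of X. -/
theorem DeltaHausdorff.isClosed_image_Iic {X : Type*} [TopologicalSpace X]
    (hX : DeltaHausdorff X) {α : unitInterval → X} (hα : Continuous α) (a : unitInterval) :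
    IsClosed (α '' Set.Iic a) := by
  have h : α '' Set.Iic a = Set.range fun t => α (min t a) := by
    ext y
    constructor
    · rintro ⟨t, ht, rfl⟩
      exact ⟨t, congrArg α (min_eq_left ht)⟩
    · rintro ⟨t, rfl⟩
      exact ⟨_, min_le_right t a, rfl⟩
  rw [h]
  exact hX _ (hα.comp (continuous_id.min continuous_const))

theorem DeltaHausdorff.isClosed_image_Ici {X : Type*} [TopologicalSpace X]
    (hX : DeltaHausdorff X) {α : unitInterval → X} (hα : Continuous α) (a : unitInterval) :
    IsClosed (α '' Set.Ici a) := by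
  have h : α '' Set.Ici a = Set.range fun t => α (max t a) := by
    ext y
    constructor
    · rintro ⟨t, ht, rfl⟩
      exact ⟨t, congrArg α (max_eq_left ht)⟩
    · rintro ⟨t, rfl⟩
      exact ⟨_, le_max_right t a, rfl⟩
  rw [h]
  exact hX _ (hα.comp (continuous_id.max continuous_const))

/-- A point outside a closed subset of `[0,1]` is separated from it by a set with closed image,
namely a union of at most two closed intervals. -/
theorem DeltaHausdorff.exists_superset_isClosed_image {X : Type*} [TopologicalSpace X]
    (hX : DeltaHausdorff X) {α : unitInterval → X} (hα : Continuous α)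
    {C : Set unitInterval} (hC : IsClosed C) {x : unitInterval} (hx : x ∉ C) :
    ∃ K, C ⊆ K ∧ x ∉ K ∧ IsClosed (α '' K) := by
  have hn : Cᶜ ∈ nhds x := hC.isOpen_compl.mem_nhds hx
  have hl : ∃ L, C ∩ Set.Iio x ⊆ L ∧ x ∉ L ∧ IsClosed (α '' L) := by
    by_cases h : ∃ l, l < x
    · obtain ⟨l, hl, hs⟩ := exists_Ioc_subset_of_mem_nhds hn h
      refine ⟨Set.Iic l, fun t ht => ?_, not_le.2 hl, hX.isClosed_image_Iic hα l⟩
      exact not_lt.1 fun hlt => hs ⟨hlt, ht.2.le⟩ ht.1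
    · exact ⟨∅, fun t ht => h ⟨t, ht.2⟩, id, by simp⟩
  have hr : ∃ R, C ∩ Set.Ioi x ⊆ R ∧ x ∉ R ∧ IsClosed (α '' R) := by
    by_cases h : ∃ u, x < u
    · obtain ⟨u, hu, hs⟩ := exists_Ico_subset_of_mem_nhds hn h
      refine ⟨Set.Ici u, fun t ht => ?_, not_le.2 hu, hX.isClosed_image_Ici hα u⟩
      exact not_lt.1 fun hlt => hs ⟨ht.2.le, hlt⟩ ht.1
    · exact ⟨∅, fun t ht => h ⟨t, ht.2⟩, id, by simp⟩
  obtain ⟨L, hCL, hxL, hL⟩ := hl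
  obtain ⟨R, hCR, hxR, hR⟩ := hr
  refine ⟨L ∪ R, fun t ht => ?_, fun h => h.elim hxL hxR, ?_⟩
  · rcases lt_trichotomy t x with h | rfl | h
    · exact Or.inl (hCL ⟨ht, h⟩)
    · exact absurd ht hx
    · exact Or.inr (hCR ⟨ht, h⟩)
  · rw [Set.image_union]
    exact hL.union hR

/-- In a Δ-Hausdorff space, every injective path is a closed embedding. -/
theorem injective_path_isClosedEmbedding
    {X : Type*} [TopologicalSpace X] (hX : DeltaHausdorff X)
    (α : unitInterval → X) (hα : Continuous α) (hinj : Function.Injective α) :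
    Topology.IsClosedEmbedding α := by
  refine .of_continuous_injective_isClosedMap hα hinj fun C hC => ?_
  refine isClosed_of_closure_subset fun y hy => ?_
  obtain ⟨x, rfl⟩ := closure_minimal (Set.image_subset_range α C) (hX α hα) hy
  by_contra h
  obtain ⟨K, hCK, hxK, hK⟩ :=
    hX.exists_superset_isClosed_image hα hC fun hx => h (Set.mem_image_of_mem α hx)
  exact hxK (hinj.mem_set_image.1 (closure_minimal (Set.image_mono hCK) hK hy))
end

section
/- Let X be a Δ-Hausdorff topological space that is path connected. Then X is arcwise connected: for any two distinct points x, y ∈ X there exists a continuous map β : [0,1] → X with β(0) = x, β(1) = y, which is a topological embedding. -/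
open Set Filter Topology unitInterval

/-- A surjective continuous closed map sends normal spaces to normal spaces. -/
theorem IsClosedMap.normalSpace_of_surjective {Y Z : Type*} [TopologicalSpace Y]
    [TopologicalSpace Z] [NormalSpace Y] {f : Y → Z} (hf : IsClosedMap f) (hc : Continuous f)
    (hs : Function.Surjective f) : NormalSpace Z := by
  refine ⟨fun A B hA hB hAB => ?_⟩
  obtain ⟨U, V, hU, hV, hAU, hBV, hUV⟩ :=
    normal_separation (hA.preimage hc) (hB.preimage hc) (hAB.preimage f)
  refine ⟨(f '' Uᶜ)ᶜ, (f '' Vᶜ)ᶜ, (hf _ hU.isClosed_compl).isOpen_compl,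
    (hf _ hV.isClosed_compl).isOpen_compl, ?_, ?_, ?_⟩
  · rintro y hy ⟨x, hx, rfl⟩
    exact hx (hAU hy)
  · rintro y hy ⟨x, hx, rfl⟩
    exact hx (hBV hy)
  · refine Set.disjoint_left.2 fun y hyU hyV => ?_
    obtain ⟨x, rfl⟩ := hs y
    have hxU : x ∈ U := by_contra fun h => hyU ⟨x, h, rfl⟩
    have hxV : x ∈ V := by_contra fun h => hyV ⟨x, h, rfl⟩
    exact Set.disjoint_left.1 hUV hxU hxV

namespace DeltaHausdorff

variable {X : Type*} [TopologicalSpace X]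

theorem t1Space (hX : DeltaHausdorff X) : T1Space X :=
  ⟨fun x => by simpa using hX (fun _ => x) continuous_const⟩

theorem isClosed_image_Icc (hX : DeltaHausdorff X) {α : I → X} (hα : Continuous α) (a b : I) :
    IsClosed (α '' Icc a b) := by
  rcases le_or_gt a b with hab | hab
  · have h : α '' Icc a b = range fun t => α (max a (min b t)) := by
      ext y
      constructor
      · rintro ⟨t, ht, rfl⟩
        exact ⟨t, by simp [ht.1, ht.2]⟩
      · rintro ⟨t, rfl⟩
        exact ⟨_, ⟨le_max_left _ _, max_le hab (min_le_left _ _)⟩, rfl⟩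
    rw [h]
    exact hX _ (by fun_prop)
  · simp [Icc_eq_empty_of_lt hab]

/-- Paths in a Δ-Hausdorff space are closed maps. -/
theorem isClosedMap (hX : DeltaHausdorff X) {α : I → X} (hα : Continuous α) :
    IsClosedMap α := by
  have := hX.t1Space
  intro K hK
  rw [← isOpen_compl_iff, isOpen_iff_mem_nhds]
  intro y hy
  have hF : IsClosed (α ⁻¹' {y}) := isClosed_singleton.preimage hα
  have hJ : ∀ k ∈ K, ∃ b c : I, Icc b c ∈ 𝓝 k ∧ Icc b c ⊆ (α ⁻¹' {y})ᶜ := by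
    intro k hk
    obtain ⟨b, c, -, h⟩ := exists_Icc_mem_subset_of_mem_nhds
      (hF.isOpen_compl.mem_nhds fun h : α k = y => hy ⟨k, hk, h⟩)
    exact ⟨b, c, h⟩
  choose! b c hbc hsub using hJ
  obtain ⟨T, hTK, hT⟩ := hK.isCompact.elim_nhds_subcover (fun k => Icc (b k) (c k)) hbc
  have hcl : IsClosed (⋃ k ∈ T, α '' Icc (b k) (c k)) :=
    T.finite_toSet.isClosed_biUnion fun k _ => hX.isClosed_image_Icc hα _ _
  refine mem_of_superset (hcl.isOpen_compl.mem_nhds ?_) (compl_subset_compl.2 ?_)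
  · simp only [mem_compl_iff, mem_iUnion, not_exists]
    rintro k hk ⟨t, ht, h⟩
    exact hsub k (hTK k hk) ht h
  · rintro _ ⟨t, ht, rfl⟩
    obtain ⟨k, hk, htk⟩ := mem_iUnion₂.1 (hT ht)
    exact mem_iUnion₂.2 ⟨k, hk, mem_image_of_mem α htk⟩

theorem t4Space_range (hX : DeltaHausdorff X) {α : I → X} (hα : Continuous α) :
    T4Space (range α) := by
  have := hX.t1Space
  have hcl : IsClosedMap (rangeFactorization α) := fun s hs => by
    have h : rangeFactorization α '' s = Subtype.val ⁻¹' (α '' s) := by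
      ext ⟨y, hy⟩
      simp [rangeFactorization, Subtype.ext_iff]
    rw [h]
    exact (hX.isClosedMap hα s hs).preimage continuous_subtype_val
  have := hcl.normalSpace_of_surjective (hα.subtype_mk _) rangeFactorization_surjective
  constructor

/-- The kernel of a path in a Δ-Hausdorff space is closed. -/
theorem isClosed_setOf_eq (hX : DeltaHausdorff X) {α : I → X} (hα : Continuous α) :
    IsClosed {p : I × I | α p.1 = α p.2} := by
  have := hX.t4Space_range hα
  have hc : Continuous (rangeFactorization α) := hα.subtype_mk _
  have h := isClosed_eq (hc.comp continuous_fst) (hc.comp continuous_snd)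
  simpa [rangeFactorization, Subtype.ext_iff] using h

end DeltaHausdorff

/-- A closed set of parameters containing the endpoints such that a path takes equal values at the
two ends of every complementary interval. -/
structure IsExcisedSet {X : Type*} (α : I → X) (K : Set I) : Prop where
  isClosed : IsClosed K
  zero_mem : 0 ∈ K
  one_mem : 1 ∈ K
  eq_of_gap : ∀ a ∈ K, ∀ b ∈ K, a < b → Disjoint (Ioo a b) K → α a = α b

namespace IsExcisedSet

variable {X : Type*} {α : I → X} {K : Set I}

theorem exists_isGreatest (hK : IsExcisedSet α K) (t : I) : ∃ r, IsGreatest (K ∩ Iic t) r :=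
  (hK.isClosed.inter isClosed_Iic).isCompact.exists_isGreatest ⟨0, hK.zero_mem, nonneg'⟩

theorem exists_isLeast (hK : IsExcisedSet α K) (t : I) : ∃ r, IsLeast (K ∩ Ici t) r :=
  (hK.isClosed.inter isClosed_Ici).isCompact.exists_isLeast ⟨1, hK.one_mem, le_one'⟩

theorem sInter_of_isChain [TopologicalSpace X] (hX : DeltaHausdorff X) (hα : Continuous α)
    {c : Set (Set I)} (hc : ∀ K ∈ c, IsExcisedSet α K) (hchain : IsChain (· ⊆ ·) c)
    (hne : c.Nonempty) : IsExcisedSet α (⋂₀ c) := by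
  refine ⟨isClosed_sInter fun K hK => (hc K hK).isClosed, fun K hK => (hc K hK).zero_mem,
    fun K hK => (hc K hK).one_mem, fun a ha b hb hab hdisj => ?_⟩
  by_contra hne'
  have hmem : {p : I × I | α p.1 = α p.2}ᶜ ∈ 𝓝 (a, b) :=
    (hX.isClosed_setOf_eq hα).isOpen_compl.mem_nhds hne'
  rw [nhds_prod_eq] at hmem
  obtain ⟨u, hu, v, hv, huv⟩ := mem_prod_iff.1 hmem
  obtain ⟨m, ham, hmb⟩ := exists_between hab
  obtain ⟨p, ⟨hap, hpm⟩, hp⟩ := (mem_nhdsGE_iff_exists_mem_Ioc_Ico_subset ham).1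
    (mem_nhdsWithin_of_mem_nhds hu)
  obtain ⟨q, ⟨hmq, hqb⟩, hq⟩ := (mem_nhdsLE_iff_exists_mem_Ico_Ioc_subset hmb).1
    (mem_nhdsWithin_of_mem_nhds hv)
  obtain ⟨p', hap', hp'⟩ := exists_between hap
  obtain ⟨q', hqq', hq'⟩ := exists_between hqb
  have : Nonempty c := hne.to_subtype
  obtain ⟨⟨K, hKc⟩, hK⟩ := (isCompact_Icc (a := p') (b := q')).elim_directed_family_closed
    (fun K : c => (K : Set I)) (fun K => (hc K K.2).isClosed)
    (by
      rw [← sInter_eq_iInter]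
      refine (hdisj.mono_left fun x hx => ?_).inter_eq
      exact ⟨hap'.trans_le hx.1, hx.2.trans_lt hq'⟩)
    (fun K L => by
      rcases hchain.total K.2 L.2 with h | h
      · exact ⟨K, subset_rfl, h⟩
      · exact ⟨L, h, subset_rfl⟩)
  have hE := hc K hKc
  obtain ⟨s, ⟨hsK, hsp⟩, hs⟩ := hE.exists_isGreatest p'
  obtain ⟨t, ⟨htK, hqt⟩, ht⟩ := hE.exists_isLeast q'
  have has : a ≤ s := hs ⟨ha K hKc, hap'.le⟩
  have htb : t ≤ b := ht ⟨hb K hKc, hq'.le⟩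
  have hpq' : p' < q' := (hp'.trans_le hpm).trans_le (hmq.trans hqq'.le)
  have hst : s < t := (lt_of_le_of_lt hsp hpq').trans_le hqt
  refine huv (mk_mem_prod (hp ⟨has, lt_of_le_of_lt hsp hp'⟩) (hq ⟨hqq'.trans_le hqt, htb⟩)) ?_
  refine hE.eq_of_gap s hsK t htK hst (Set.disjoint_left.2 fun x hx hxK => ?_)
  rcases le_or_gt x p' with hxp | hxp
  · exact hx.1.not_ge (hs ⟨hxK, hxp⟩)
  rcases le_or_gt q' x with hxq | hxq
  · exact hx.2.not_ge (ht ⟨hxK, hxq⟩)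
  · have : x ∈ Icc p' q' ∩ K := ⟨⟨hxp.le, hxq.le⟩, hxK⟩
    rw [hK] at this
    exact this

theorem diff_Ioo (hK : IsExcisedSet α K) {s t : I} (hs : s ∈ K) (ht : t ∈ K)
    (hst : α s = α t) : IsExcisedSet α (K \ Ioo s t) := by
  refine ⟨hK.isClosed.sdiff isOpen_Ioo, ⟨hK.zero_mem, fun h => not_lt_zero h.1⟩,
    ⟨hK.one_mem, fun h => h.2.not_ge le_one'⟩, fun a ha b hb hab hdisj => ?_⟩
  by_cases h : Disjoint (Ioo a b) K
  · exact hK.eq_of_gap a ha.1 b hb.1 hab h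
  obtain ⟨c, hc, hcK⟩ := Set.not_disjoint_iff.1 h
  have hcst : c ∈ Ioo s t := by_contra fun h' => Set.disjoint_left.1 hdisj hc ⟨hcK, h'⟩
  have has : a ≤ s := not_lt.1 fun h' => ha.2 ⟨h', hc.1.trans hcst.2⟩
  have htb : t ≤ b := not_lt.1 fun h' => hb.2 ⟨hcst.1.trans hc.2, h'⟩
  have has' : a = s := has.antisymm <| not_lt.1 fun h' =>
    Set.disjoint_left.1 hdisj ⟨h', hcst.1.trans hc.2⟩ ⟨hs, fun h => h.1.false⟩
  have htb' : t = b := htb.antisymm <| not_lt.1 fun h' =>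
    Set.disjoint_left.1 hdisj ⟨hc.1.trans hcst.2, h'⟩ ⟨ht, fun h => h.2.false⟩
  rw [has', ← htb', hst]

theorem exists_minimal [TopologicalSpace X] (hX : DeltaHausdorff X) (hα : Continuous α) :
    ∃ K, Minimal (IsExcisedSet α) K := by
  obtain ⟨K, -, hK⟩ := zorn_superset_nonempty {K | IsExcisedSet α K}
    (fun c hc hchain hne => ⟨⋂₀ c, sInter_of_isChain hX hα hc hchain hne,
      fun _ hs => sInter_subset_of_mem hs⟩) univ
    ⟨isClosed_univ, mem_univ _, mem_univ _, fun a _ b _ hab h => by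
      simp [disjoint_univ, Ioo_eq_empty_iff, hab] at h⟩
  exact ⟨K, hK⟩

theorem _root_.Minimal.disjoint_Ioo_of_isExcisedSet (hK : Minimal (IsExcisedSet α) K) {s t : I}
    (hs : s ∈ K) (ht : t ∈ K) (hst : α s = α t) : Disjoint (Ioo s t) K :=
  Set.disjoint_left.2 fun _ hx hxK => (hK.2 (hK.1.diff_Ioo hs ht hst) sdiff_subset hxK).2 hx

end IsExcisedSet

/-- The map sending `t` to the greatest element of `K` that is at most `t` is right-continuous. -/
theorem IsClosed.continuousWithinAt_Ici_of_isGreatest {L : Type*} [LinearOrder L]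
    [TopologicalSpace L] [OrderTopology L] {K : Set L} (hK : IsClosed K) {ρ : L → L}
    (hρ : ∀ t, IsGreatest (K ∩ Iic t) (ρ t)) (t : L) : ContinuousWithinAt ρ (Ici t) t := by
  refine tendsto_order.2 ⟨fun a ha => ?_, fun a ha => ?_⟩
  · filter_upwards [self_mem_nhdsWithin] with x (hx : t ≤ x)
    exact ha.trans_le ((hρ x).2 ⟨(hρ t).1.1, (hρ t).1.2.trans hx⟩)
  · by_cases ht : t ∈ K
    · have hta : t < a := lt_of_le_of_lt ((hρ t).2 ⟨ht, le_rfl⟩) ha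
      filter_upwards [mem_nhdsWithin_of_mem_nhds (Iio_mem_nhds hta)] with x (hx : x < a)
      exact lt_of_le_of_lt (hρ x).1.2 hx
    · have hI : ∀ᶠ x in 𝓝[≥] t, Icc t x ⊆ Kᶜ :=
        (tendsto_const_pure.mono_right (pure_le_nhdsWithin self_mem_Ici) |>.Icc tendsto_id).eventually
          (eventually_smallSets.2 ⟨Kᶜ, mem_nhdsWithin_of_mem_nhds (hK.isOpen_compl.mem_nhds ht),
            fun _ h => h⟩)
      filter_upwards [hI] with x hx
      refine lt_of_le_of_lt ((hρ t).2 ⟨(hρ x).1.1, not_lt.1 fun h => ?_⟩) ha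
      exact hx ⟨h.le, (hρ x).1.2⟩ (hρ x).1.1

theorem DeltaHausdorff.exists_path_ordConnected_fibers {X : Type*} [TopologicalSpace X]
    (hX : DeltaHausdorff X) {α : I → X} (hα : Continuous α) :
    ∃ β : I → X, Continuous β ∧ β 0 = α 0 ∧ β 1 = α 1 ∧
      ∀ s t, β s = β t → ∀ u ∈ Icc s t, β u = β s := by
  obtain ⟨K, hK⟩ := IsExcisedSet.exists_minimal hX hα
  have hE := hK.1
  choose ρ hρ using hE.exists_isGreatest
  choose l hl using hE.exists_isLeast
  have hρl : α ∘ ρ = α ∘ l := by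
    funext t
    rcases ((hρ t).1.2.trans (hl t).1.2 : ρ t ≤ l t).eq_or_lt with h | h
    · exact congrArg α h
    · refine hE.eq_of_gap _ (hρ t).1.1 _ (hl t).1.1 h (Set.disjoint_left.2 fun x hx hxK => ?_)
      rcases le_total x t with hxt | hxt
      · exact hx.1.not_ge ((hρ t).2 ⟨hxK, hxt⟩)
      · exact hx.2.not_ge ((hl t).2 ⟨hxK, hxt⟩)
  refine ⟨α ∘ ρ, continuous_iff_continuousAt.2 fun t => ?_, ?_, ?_, fun s t hst u hu => ?_⟩
  · refine continuousAt_iff_continuous_left_right.2 ⟨?_, ?_⟩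
    · rw [hρl]
      refine hα.continuousAt.comp_continuousWithinAt ?_
      exact hE.isClosed.continuousWithinAt_Ici_of_isGreatest (L := Iᵒᵈ) (ρ := l) hl t
    · exact hα.continuousAt.comp_continuousWithinAt
        (hE.isClosed.continuousWithinAt_Ici_of_isGreatest hρ t)
  · exact congrArg α (le_antisymm (hρ 0).1.2 nonneg')
  · exact congrArg α (le_antisymm le_one' ((hρ 1).2 ⟨hE.one_mem, self_mem_Iic⟩))
  · have hd := hK.disjoint_Ioo_of_isExcisedSet (hρ s).1.1 (hρ t).1.1 hst
    have hsu : ρ s ≤ ρ u := (hρ u).2 ⟨(hρ s).1.1, (hρ s).1.2.trans hu.1⟩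
    have hut : ρ u ≤ ρ t := (hρ t).2 ⟨(hρ u).1.1, (hρ u).1.2.trans hu.2⟩
    rcases hsu.eq_or_lt with h | h
    · exact congrArg α h.symm
    rcases hut.eq_or_lt with h' | h'
    · exact (congrArg α h').trans hst.symm
    · exact (Set.disjoint_left.1 hd ⟨h, h'⟩ (hρ u).1.1).elim

/-- A continuous monotone function that is constant on the fibers of `β` and separates
`β p` from `β q`. -/
theorem DeltaHausdorff.exists_monotone_separating {X : Type*} [TopologicalSpace X]
    (hX : DeltaHausdorff X) {β : I → X} (hβ : Continuous β)
    (hfib : ∀ s t, β s = β t → ∀ u ∈ Icc s t, β u = β s) (p q : I) :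
    ∃ f : I → ℝ, Continuous f ∧ Monotone f ∧ (∀ t, f t ∈ Icc (0 : ℝ) 1) ∧
      (∀ s t, β s = β t → f s = f t) ∧
      (p ≤ q → β p ≠ β q → (∀ s ≤ p, f s = 0) ∧ ∀ t, q ≤ t → f t = 1) := by
  by_cases hpq : p ≤ q ∧ β p ≠ β q
  swap
  · exact ⟨fun _ => 0, continuous_const, monotone_const, by simp, by simp,
      fun h h' => (hpq ⟨h, h'⟩).elim⟩
  obtain ⟨hpq, hne⟩ := hpq
  have := hX.t4Space_range hβ
  obtain ⟨h, h0, h1, h01⟩ := exists_continuous_zero_one_of_isClosed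
    (X := range β) (s := Subtype.val ⁻¹' (β '' Icc 0 p)) (t := Subtype.val ⁻¹' (β '' Icc q 1))
    ((hX.isClosed_image_Icc hβ _ _).preimage continuous_subtype_val)
    ((hX.isClosed_image_Icc hβ _ _).preimage continuous_subtype_val)
    (by
      refine Disjoint.preimage _ (Set.disjoint_left.2 ?_)
      rintro _ ⟨s, hs, rfl⟩ ⟨t, ht, hts⟩
      have hst := hfib s t hts.symm
      exact hne ((hst p ⟨hs.2, hpq.trans ht.1⟩).trans (hst q ⟨hs.2.trans hpq, ht.1⟩).symm))
  set φ : I → ℝ := fun t => h ⟨β t, mem_range_self t⟩ with hφ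
  have hφc : Continuous φ := h.continuous.comp (hβ.subtype_mk _)
  have hφ01 : ∀ t, φ t ∈ Icc (0 : ℝ) 1 := fun t => h01 _
  set f : I → ℝ := fun t => sSup ((fun v => φ (min v t)) '' univ) with hf
  have hbdd : ∀ t, BddAbove ((fun v => φ (min v t)) '' univ) := fun t =>
    ⟨1, by rintro _ ⟨v, -, rfl⟩; exact (hφ01 _).2⟩
  have hle : ∀ {s t}, s ≤ t → φ s ≤ f t := fun {s t} hst =>
    le_csSup (hbdd t) ⟨s, mem_univ _, by simp [hst]⟩
  have hfle : ∀ {t c}, (∀ s ≤ t, φ s ≤ c) → f t ≤ c := fun {t c} H =>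
    csSup_le (univ_nonempty.image _) (by rintro _ ⟨v, -, rfl⟩; exact H _ (min_le_right _ _))
  have hmono : Monotone f := fun s t hst => hfle fun u hu => hle (hu.trans hst)
  have hf01 : ∀ t, f t ∈ Icc (0 : ℝ) 1 := fun t =>
    ⟨(hφ01 t).1.trans (hle le_rfl), hfle fun s _ => (hφ01 s).2⟩
  have hconst : ∀ s t, s ≤ t → β s = β t → f s = f t := fun s t hst hβst =>
    (hmono hst).antisymm <| hfle fun u hu => by
      rcases le_total u s with hus | hus
      · exact hle hus
      · have : φ u = φ s := by simp only [hφ, hfib s t hβst u ⟨hus, hu⟩]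
        exact this.trans_le (hle le_rfl)
  refine ⟨f, isCompact_univ.continuous_sSup ?_, hmono, hf01, fun s t hst => ?_, fun _ _ =>
    ⟨fun s hs => ?_, fun t ht => ?_⟩⟩
  · exact hφc.comp (continuous_snd.min continuous_fst)
  · rcases le_total s t with h | h
    · exact hconst s t h hst
    · exact (hconst t s h hst.symm).symm
  · refine le_antisymm (hfle fun u hu => ?_) (hf01 s).1
    exact (h0 ⟨u, ⟨nonneg', hu.trans hs⟩, rfl⟩).le
  · refine le_antisymm (hf01 t).2 ?_
    exact (h1 ⟨q, ⟨le_rfl, le_one'⟩, rfl⟩).ge.trans (hle ht)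

/-- A path with order-connected fibers factors through a continuous monotone function. -/
theorem DeltaHausdorff.exists_monotone_eq_iff {X : Type*} [TopologicalSpace X]
    (hX : DeltaHausdorff X) {β : I → X} (hβ : Continuous β)
    (hfib : ∀ s t, β s = β t → ∀ u ∈ Icc s t, β u = β s) :
    ∃ g : I → ℝ, Continuous g ∧ Monotone g ∧ ∀ s t, g s = g t ↔ β s = β t := by
  obtain ⟨D, hDc, hDd⟩ := TopologicalSpace.exists_countable_dense I
  have hne : (D ×ˢ D).Nonempty := hDd.nonempty.prod hDd.nonempty
  obtain ⟨e, he⟩ := (hDc.prod hDc).exists_eq_range hne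
  choose f hfc hfm hf01 hfeq hfsep using
    fun n => hX.exists_monotone_separating hβ hfib (e n).1 (e n).2
  have hbound : ∀ n t, (1 / 2 : ℝ) ^ n * f n t ≤ (1 / 2 : ℝ) ^ n := fun n t =>
    mul_le_of_le_one_right (by positivity) (hf01 n t).2
  have hnonneg : ∀ n t, 0 ≤ (1 / 2 : ℝ) ^ n * f n t := fun n t =>
    mul_nonneg (by positivity) (hf01 n t).1
  have hsum : ∀ t, Summable fun n => (1 / 2 : ℝ) ^ n * f n t := fun t =>
    summable_geometric_two.of_nonneg_of_le (fun n => hnonneg n t) (fun n => hbound n t)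
  have hmono : Monotone fun t => ∑' n, (1 / 2 : ℝ) ^ n * f n t := fun s t hst =>
    (hsum s).tsum_le_tsum (fun n => by gcongr; exact hfm n hst) (hsum t)
  have hlt : ∀ s t, s ≤ t → β s ≠ β t →
      ∑' n, (1 / 2 : ℝ) ^ n * f n s < ∑' n, (1 / 2 : ℝ) ^ n * f n t := by
    intro s t hst hβst
    have hst' : s < t := hst.lt_of_ne fun h => hβst (congrArg β h)
    obtain ⟨⟨p, q⟩, hpq, hpqD⟩ : ∃ x ∈ (Ioo s t ×ˢ Ioo s t) ∩ {x : I × I | β x.1 ≠ β x.2},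
        x ∈ D ×ˢ D := by
      refine (hDd.prod hDd).exists_mem_open ?_ ?_ |>.imp fun x hx => ⟨hx.2, hx.1⟩
      · exact (isOpen_Ioo.prod isOpen_Ioo).inter (hX.isClosed_setOf_eq hβ).isOpen_compl
      · by_contra! hempty
        have hcl : closure (Ioo s t ×ˢ Ioo s t) ⊆ {x : I × I | β x.1 = β x.2} :=
          closure_minimal (fun x hx => by_contra fun h => (hempty.subset ⟨hx, h⟩ : x ∈ (∅ : Set _)))
            (hX.isClosed_setOf_eq hβ)
        rw [closure_prod_eq, closure_Ioo hst'.ne] at hcl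
        exact hβst (hcl (mk_mem_prod (left_mem_Icc.2 hst) (right_mem_Icc.2 hst)))
    wlog hle : p ≤ q generalizing p q
    · exact this q p ⟨⟨hpq.1.2, hpq.1.1⟩, fun h => hpq.2 h.symm⟩ ⟨hpqD.2, hpqD.1⟩ (le_of_not_ge hle)
    obtain ⟨n, hn⟩ : (p, q) ∈ range e := he ▸ hpqD
    have hsep := hfsep n
    rw [hn] at hsep
    obtain ⟨hs, ht⟩ := hsep hle hpq.2
    refine (hsum s).tsum_lt_tsum (i := n) (fun n => by gcongr; exact hfm n hst) ?_ (hsum t)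
    simp [hs s hpq.1.1.1.le, ht t hpq.1.2.2.le]
  refine ⟨fun t => ∑' n, (1 / 2 : ℝ) ^ n * f n t, ?_, hmono, fun s t => ⟨fun h => ?_, fun h => ?_⟩⟩
  · refine continuous_tsum (fun n => continuous_const.mul (hfc n)) summable_geometric_two
      fun n t => ?_
    rw [Real.norm_of_nonneg (hnonneg n t)]
    exact hbound n t
  · by_contra hβst
    rcases le_total s t with hst | hst
    · exact (hlt s t hst hβst).ne h
    · exact (hlt t s hst (Ne.symm hβst)).ne h.symm
  · exact tsum_congr fun n => by rw [hfeq n s t h]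

/-- Every path-connected Δ-Hausdorff space is arcwise connected. -/
theorem path_connected_deltaHausdorff_arcwise_connected
    {X : Type*} [TopologicalSpace X] (hX : DeltaHausdorff X)
    (hpc : ∀ x y : X, ∃ α : unitInterval → X, Continuous α ∧ α 0 = x ∧ α 1 = y) :
    ∀ x y : X, x ≠ y →
      ∃ β : unitInterval → X, Continuous β ∧ β 0 = x ∧ β 1 = y ∧
        Topology.IsEmbedding β := by
  intro x y hxy
  obtain ⟨α, hα, rfl, rfl⟩ := hpc x y
  obtain ⟨β, hβ, hβ0, hβ1, hfib⟩ := hX.exists_path_ordConnected_fibers hα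
  obtain ⟨g, hg, hgm, hgβ⟩ := hX.exists_monotone_eq_iff hβ hfib
  rw [← hβ0, ← hβ1] at hxy ⊢
  have h01 : g 0 < g 1 := (hgm nonneg').lt_of_ne fun h => hxy ((hgβ 0 1).1 h)
  let k : I → Icc (g 0) (g 1) := fun t => ⟨g t, hgm nonneg', hgm le_one'⟩
  have hk : Continuous k := hg.subtype_mk _
  have hks : Function.Surjective k := fun ⟨z, hz⟩ => by
    obtain ⟨t, ht⟩ := mem_range_of_exists_le_of_exists_ge hg ⟨0, hz.1⟩ ⟨1, hz.2⟩
    exact ⟨t, Subtype.ext ht⟩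
  have hkβ : ∀ s t, k s = k t ↔ β s = β t := fun s t => Subtype.ext_iff.trans (hgβ s t)
  let θ := (iccHomeoI (g 0) (g 1) h01).symm
  let γ : I → X := fun t => β (Function.surjInv hks (θ t))
  have hγ : ∀ s t, k s = θ t → γ t = β s := fun s t h =>
    (hkβ _ _).1 ((Function.surjInv_eq hks _).trans h.symm)
  have hγc : Continuous γ := by
    have hq := IsQuotientMap.of_surjective_continuous (θ.symm.surjective.comp hks)
      (θ.symm.continuous.comp hk)
    rw [hq.continuous_iff]
    convert hβ using 1
    funext t
    exact hγ _ _ (θ.apply_symm_apply _).symm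
  have hinj : Function.Injective γ := fun s t hst => by
    have := (hkβ _ _).2 hst
    rw [Function.surjInv_eq hks, Function.surjInv_eq hks] at this
    exact θ.injective this
  refine ⟨γ, hγc, hγ _ _ ?_, hγ _ _ ?_,
    (IsClosedEmbedding.of_continuous_injective_isClosedMap hγc hinj
      (hX.isClosedMap hγc)).isEmbedding⟩
  · ext; simp [k, θ]
  · ext; simp [k, θ]
end

section
/- Let 𝒰 be a collection of open intervals contained in (0,1) whose closures are pairwise disjoint, and let Γ and Γ′ be two collapsing functions for 𝒰. Then there exists an increasing homeomorphism h : [0,1] → [0,1] such that h ∘ Γ = Γ′. -/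
open Set in
/-- A collection of nondegenerate closed intervals with pairwise disjoint members is countable. -/
lemma countable_of_pairwise_disjoint_Icc {U : Set (ℝ × ℝ)} (hlt : ∀ p ∈ U, p.1 < p.2)
    (hdisj : U.Pairwise fun p q => Disjoint (Icc p.1 p.2) (Icc q.1 q.2)) : U.Countable :=
  Set.PairwiseDisjoint.countable_of_nonempty_interior (s := fun p : ℝ × ℝ => Icc p.1 p.2) hdisj
    fun p hp => by simpa [interior_Icc] using hlt p hp

open Set in
/-- A level set of one collapsing function is contained in a level set of any other one. -/
lemma IsCollapsingFunction.eq_of_eq {U : Set (ℝ × ℝ)} {Γ Γ' : ℝ → ℝ} (hU : U.Countable)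
    (hΓ : IsCollapsingFunction U Γ) (hΓ' : IsCollapsingFunction U Γ') {s t : ℝ}
    (hs : s ∈ Icc (0 : ℝ) 1) (ht : t ∈ Icc (0 : ℝ) 1) (hst : s ≤ t) (h : Γ s = Γ t) :
    Γ' s = Γ' t := by
  obtain ⟨-, hmono, -, -, hstrict⟩ := hΓ
  obtain ⟨hcont', hmono', -, hconst', -⟩ := hΓ'
  have hsub : Icc s t ⊆ Icc 0 1 := Icc_subset_Icc hs.1 ht.2
  have hlevel : ∀ x ∈ Icc s t, Γ x = Γ s := fun x hx =>
    le_antisymm ((hmono (hsub hx) ht hx.2).trans_eq h.symm) (hmono hs (hsub hx) hx.1)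
  have hsing : (Icc s t \ ⋃ p ∈ U, Icc p.1 p.2).Subsingleton := fun x hx y hy =>
    hstrict.injOn ⟨hsub hx.1, hx.2⟩ ⟨hsub hy.1, hy.2⟩
      ((hlevel x hx.1).trans (hlevel y hy.1).symm)
  have hcount : (Γ' '' Icc s t).Countable := by
    refine ((hsing.countable.image Γ').union (hU.image fun p => Γ' p.1)).mono ?_
    rintro _ ⟨x, hx, rfl⟩
    by_cases hxU : x ∈ ⋃ p ∈ U, Icc p.1 p.2
    · obtain ⟨p, hp, hxp⟩ := mem_iUnion₂.1 hxU
      exact Or.inr ⟨p, hp, hconst' p hp _ (left_mem_Icc.2 (hxp.1.trans hxp.2)) x hxp⟩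
    · exact Or.inl ⟨x, ⟨hx, hxU⟩, rfl⟩
  by_contra hne
  have hlt : Γ' s < Γ' t := lt_of_le_of_ne (hmono' hs ht hst) hne
  exact Cardinal.Real.Icc_countable_iff.not.2 hlt.not_ge
    (hcount.mono (intermediate_value_Icc hst (hcont'.mono hsub)))

open Set in
/-- A strictly increasing function mapping an order-connected set onto an order-connected set
is continuous on it. -/
lemma StrictMonoOn.continuousOn_of_ordConnected_image {f : ℝ → ℝ} {s : Set ℝ} [s.OrdConnected]
    (hf : StrictMonoOn f s) (himg : (f '' s).OrdConnected) : ContinuousOn f s := by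
  rw [continuousOn_iff_continuous_domRestrict]
  exact continuous_subtype_val.comp (hf.orderIso f s).continuous

/-- Any two collapsing functions for the same collection of open intervals in
`(0,1)` with pairwise-disjoint closures differ by an increasing homeomorphism
of `[0,1]` (a continuous strictly increasing self-surjection of `[0,1]`). -/
theorem collapsing_functions_unique_up_to_homeomorphism (U : Set (ℝ × ℝ))
    (hsub : ∀ p ∈ U, 0 ≤ p.1 ∧ p.1 < p.2 ∧ p.2 ≤ 1)
    (hdisj : U.Pairwise fun p q => Disjoint (Set.Icc p.1 p.2) (Set.Icc q.1 q.2))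
    (Γ Γ' : ℝ → ℝ)
    (hΓ : IsCollapsingFunction U Γ) (hΓ' : IsCollapsingFunction U Γ') :
    ∃ h : ℝ → ℝ, ContinuousOn h (Set.Icc 0 1) ∧ StrictMonoOn h (Set.Icc 0 1) ∧
      h '' Set.Icc 0 1 = Set.Icc 0 1 ∧ ∀ t ∈ Set.Icc (0 : ℝ) 1, h (Γ t) = Γ' t := by
  have hU := countable_of_pairwise_disjoint_Icc (fun p hp => (hsub p hp).2.1) hdisj
  obtain ⟨h, hcomp⟩ : ∃ h : ℝ → ℝ, ∀ t ∈ Set.Icc (0 : ℝ) 1, h (Γ t) = Γ' t := by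
    refine ⟨fun y => Γ' (Function.invFunOn Γ (Set.Icc 0 1) y), fun t ht => ?_⟩
    have hmem := Function.invFunOn_mem (f := Γ) ⟨t, ht, rfl⟩
    have heq := Function.invFunOn_eq (f := Γ) ⟨t, ht, rfl⟩
    rcases le_total (Function.invFunOn Γ (Set.Icc 0 1) (Γ t)) t with hle | hle
    · exact hΓ.eq_of_eq hU hΓ' hmem ht hle heq
    · exact (hΓ.eq_of_eq hU hΓ' ht hmem hle heq.symm).symm
  have hstrict : StrictMonoOn h (Set.Icc 0 1) := by
    rw [← hΓ.2.2.1]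
    rintro _ ⟨s, hs, rfl⟩ _ ⟨t, ht, rfl⟩ hlt
    have hst : s ≤ t := (hΓ.2.1.reflect_lt hs ht hlt).le
    rw [hcomp s hs, hcomp t ht]
    exact lt_of_le_of_ne (hΓ'.2.1 hs ht hst)
      fun heq => hlt.ne (hΓ'.eq_of_eq hU hΓ hs ht hst heq)
  have himg : h '' Set.Icc 0 1 = Set.Icc 0 1 :=
    calc h '' Set.Icc 0 1 = h '' (Γ '' Set.Icc 0 1) := by rw [hΓ.2.2.1]
      _ = Γ' '' Set.Icc 0 1 := (Set.image_image _ _ _).trans (Set.image_congr hcomp)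
      _ = Set.Icc 0 1 := hΓ'.2.2.1
  exact ⟨h, hstrict.continuousOn_of_ordConnected_image (himg.symm ▸ Set.ordConnected_Icc),
    hstrict, himg, hcomp⟩
end

section
/- Let X be a T1 topological space and let α : [0,1] → X be a continuous map with α(0) ≠ α(1) that is monotone, i.e., every fiber α⁻¹(x), x ∈ X, is connected. Then there exists a continuous injective map β : [0,1] → X with β(0) = α(0), β(1) = α(1), and β([0,1]) = α([0,1]). -/
open Set Topology in
/-- A countable subset of the unit interval without extreme elements, and dense as an order,
is the trace of a monotone map of the unit interval onto itself. -/
theorem exists_monotone_continuous_strictMonoOn (C : Set unitInterval) (hC : C.Countable)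
    [Nonempty C] [DenselyOrdered C] [NoMinOrder C] [NoMaxOrder C] :
    ∃ φ : unitInterval → unitInterval, Continuous φ ∧ Function.Surjective φ ∧
      StrictMonoOn φ C ∧ Monotone φ ∧ ∀ s t, (∀ c ∈ C, c ≤ s ↔ c ≤ t) → φ s = φ t := by
  obtain ⟨D, hDc, hDd, hbot, htop⟩ := exists_countable_dense_no_bot_top unitInterval
  have hpos : ∀ x ∈ D, (0 : unitInterval) < x := fun x hx =>
    unitInterval.pos_iff_ne_zero.2 fun h => hbot x (h ▸ fun y => unitInterval.nonneg') hx
  have hlt : ∀ x ∈ D, x < (1 : unitInterval) := fun x hx =>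
    unitInterval.lt_one_iff_ne_one.2 fun h => htop x (h ▸ fun y => unitInterval.le_one') hx
  have : Countable C := hC.to_subtype
  have : Countable D := hDc.to_subtype
  have : Nonempty D := hDd.nonempty.to_subtype
  have : DenselyOrdered D := ⟨fun a b hab => by
    obtain ⟨x, hx, h⟩ := hDd.exists_between (show (a : unitInterval) < b from hab)
    exact ⟨⟨x, hx⟩, h.1, h.2⟩⟩
  have : NoMinOrder D := ⟨fun a => by
    obtain ⟨x, hx, h⟩ := hDd.exists_between (hpos a a.2)
    exact ⟨⟨x, hx⟩, h.2⟩⟩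
  have : NoMaxOrder D := ⟨fun a => by
    obtain ⟨x, hx, h⟩ := hDd.exists_between (hlt a a.2)
    exact ⟨⟨x, hx⟩, h.1⟩⟩
  obtain ⟨e⟩ := Order.iso_of_countable_dense C D
  let φ : unitInterval → unitInterval := fun t =>
    sSup {x | ∃ c : C, (c : unitInterval) ≤ t ∧ x = e c}
  have hφm : Monotone φ := fun s t hst =>
    sSup_le_sSup fun x ⟨c, hc, hx⟩ => ⟨c, hc.trans hst, hx⟩
  have hφe : ∀ c : C, φ c = e c := fun c => le_antisymm
    (sSup_le fun x ⟨d, hd, hx⟩ => hx ▸ e.monotone hd) (le_sSup ⟨c, le_rfl, rfl⟩)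
  have hDφ : D ⊆ range φ := fun x hx =>
    ⟨e.symm ⟨x, hx⟩, by rw [hφe, e.apply_symm_apply]⟩
  have hφc : Continuous φ := hφm.continuous_of_denseRange (hDd.mono hDφ)
  refine ⟨φ, hφc, ?_, ?_, hφm, ?_⟩
  · rw [← range_eq_univ, ← (isCompact_range hφc).isClosed.closure_eq]
    exact (hDd.mono hDφ).closure_eq
  · intro a ha b hb hab
    rw [hφe ⟨a, ha⟩, hφe ⟨b, hb⟩]
    exact e.strictMono (show (⟨a, ha⟩ : C) < ⟨b, hb⟩ from hab)
  · intro s t h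
    have : {x | ∃ c : C, (c : unitInterval) ≤ s ∧ x = (e c : unitInterval)} =
        {x | ∃ c : C, (c : unitInterval) ≤ t ∧ x = (e c : unitInterval)} := by
      ext x
      exact exists_congr fun c => and_congr_left fun _ => h c c.2
    exact congrArg sSup this

open Set Topology in
/-- A dense set meets the open interval between two distinct fibers of a monotone path, outside
both fibers. -/
theorem exists_mem_between_fibers {X : Type*} [TopologicalSpace X] [T1Space X]
    {α : unitInterval → X} (hα : Continuous α)
    (hmono : ∀ x : X, IsPreconnected (α ⁻¹' {x})) {D : Set unitInterval} (hD : Dense D)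
    {s t : unitInterval} (hst : s < t) (hne : α s ≠ α t) :
    ∃ u ∈ D, s < u ∧ u < t ∧ α u ≠ α s ∧ α u ≠ α t := by
  have hcl : ∀ x, IsClosed (α ⁻¹' {x}) := fun x => isClosed_singleton.preimage hα
  set l := sInf (α ⁻¹' {α t})
  have hl : α l = α t := (hcl (α t)).isCompact.sInf_mem ⟨t, rfl⟩
  have hlt : l ≤ t := sInf_le rfl
  have hsl : s < l := by
    by_contra! h
    exact hne ((hmono (α t)).ordConnected.out hl rfl ⟨h, hst.le⟩)
  by_contra! H
  have hsub : Ioo s l ∩ D ⊆ α ⁻¹' {α s} := by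
    rintro u ⟨⟨hsu, hul⟩, hu⟩
    by_contra hus
    exact hul.not_ge (sInf_le (show u ∈ α ⁻¹' {α t} from H u hu hsu (hul.trans_le hlt) hus))
  have hmem : l ∈ closure (Ioo s l ∩ D) := by
    refine closure_minimal (hD.open_subset_closure_inter isOpen_Ioo) isClosed_closure ?_
    rw [closure_Ioo hsl.ne]
    exact right_mem_Icc.2 hsl.le
  have : α l = α s := (hcl (α s)).closure_subset_iff.2 hsub hmem
  exact hne (this.symm.trans hl)

open Set Topology in
/-- The fibers of a monotone path with distinct endpoints are the fibers of a monotone continuous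
surjection of the unit interval onto itself. -/
theorem exists_monotone_continuous_same_fibers {X : Type*} [TopologicalSpace X] [T1Space X]
    {α : unitInterval → X} (hα : Continuous α) (hne : α 0 ≠ α 1)
    (hmono : ∀ x : X, IsPreconnected (α ⁻¹' {x})) :
    ∃ φ : unitInterval → unitInterval, Continuous φ ∧ Function.Surjective φ ∧ Monotone φ ∧
      ∀ s t, φ s = φ t ↔ α s = α t := by
  obtain ⟨D, hDc, hD⟩ := TopologicalSpace.exists_countable_dense unitInterval
  have between {s t : unitInterval} := exists_mem_between_fibers hα hmono hD (s := s) (t := t)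
  let L : unitInterval → unitInterval := fun t => sInf (α ⁻¹' {α t})
  have hL : ∀ t, α (L t) = α t := fun t =>
    (isClosed_singleton.preimage hα).isCompact.sInf_mem ⟨t, rfl⟩
  have hLle : ∀ {s t}, α s = α t → L t ≤ s := fun h => sInf_le h
  have hLlt : ∀ {s t}, s < t → α s ≠ α t → s < L t := by
    intro s t hst h
    by_contra! h'
    exact h ((hmono (α t)).ordConnected.out (hL t) rfl ⟨h', hst.le⟩)
  let C : Set unitInterval := L '' {u ∈ D | α u ≠ α 0 ∧ α u ≠ α 1}
  have hpos : ∀ {u}, α u ≠ α 0 → 0 < u := fun h =>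
    unitInterval.pos_iff_ne_zero.2 fun h' => h (h' ▸ rfl)
  have hlt1 : ∀ {u}, α u ≠ α 1 → u < 1 := fun h =>
    unitInterval.lt_one_iff_ne_one.2 fun h' => h (h' ▸ rfl)
  have hends : ∀ {s t u}, s < u → u < t → α u ≠ α s → α u ≠ α t → α u ≠ α 0 ∧ α u ≠ α 1 := by
    intro s t u hsu hut hs ht
    constructor <;> intro h
    · exact hs ((hmono (α u)).ordConnected.out h.symm rfl ⟨unitInterval.nonneg', hsu.le⟩).symm
    · exact ht ((hmono (α u)).ordConnected.out rfl h.symm ⟨hut.le, unitInterval.le_one'⟩).symm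
  have hCb : ∀ {s t}, s < t → α s ≠ α t → ∃ c ∈ C, s < c ∧ c < L t ∧ α c ≠ α s ∧ α c ≠ α t := by
    intro s t hst h
    obtain ⟨u, hu, hsu, hut, hus, hut'⟩ := between hst h
    refine ⟨L u, ⟨u, ⟨hu, hends hsu hut hus hut'⟩, rfl⟩, hLlt hsu hus.symm,
      (hLle rfl).trans_lt (hLlt hut hut'), ?_, ?_⟩ <;> rwa [hL]
  have hCne : ∀ c ∈ C, α c ≠ α 0 ∧ α c ≠ α 1 := by
    rintro _ ⟨u, hu, rfl⟩
    rw [hL]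
    exact hu.2
  have hCL : ∀ {c s}, c ∈ C → α c = α s → c = L s := by
    rintro _ s ⟨u, hu, rfl⟩ h
    rw [hL] at h
    simp only [L, h]
  have hCinj : ∀ {c d}, c ∈ C → d ∈ C → c < d → α c ≠ α d := fun hc hd hcd h =>
    hcd.ne ((hCL hc h).trans (hCL hd rfl).symm)
  have : Nonempty C := by
    obtain ⟨c, hc, -⟩ := hCb zero_lt_one hne
    exact ⟨c, hc⟩
  have : DenselyOrdered C := ⟨fun a b hab => by
    obtain ⟨c, hc, h1, h2, -⟩ := hCb hab (hCinj a.2 b.2 hab)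
    exact ⟨⟨c, hc⟩, h1, h2.trans_le (hLle rfl)⟩⟩
  have : NoMinOrder C := ⟨fun a => by
    obtain ⟨c, hc, h1, h2, -⟩ := hCb (hpos (hCne a a.2).1) (hCne a a.2).1.symm
    exact ⟨⟨c, hc⟩, h2.trans_le (hLle rfl)⟩⟩
  have : NoMaxOrder C := ⟨fun a => by
    obtain ⟨c, hc, h1, -⟩ := hCb (hlt1 (hCne a a.2).2) (hCne a a.2).2
    exact ⟨⟨c, hc⟩, h1⟩⟩
  obtain ⟨φ, hφc, hφs, hφC, hφm, hφ⟩ :=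
    exists_monotone_continuous_strictMonoOn C ((hDc.mono (sep_subset _ _)).image L)
  have hsep : ∀ {s t}, s < t → α s ≠ α t → φ s < φ t := by
    intro s t hst h
    obtain ⟨c, hc, hsc, hct, hcs, hct'⟩ := hCb hst h
    have hct := hct.trans_le (hLle rfl)
    obtain ⟨d, hd, hcd, hdt, -⟩ := hCb hct hct'
    exact (hφm hsc.le).trans_lt ((hφC hc hd hcd).trans_le (hφm (hdt.le.trans (hLle rfl))))
  refine ⟨φ, hφc, hφs, hφm, fun s t => ⟨fun h => ?_, fun h => hφ s t fun c hc => ?_⟩⟩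
  · by_contra hst
    rcases lt_trichotomy s t with h' | h' | h'
    · exact (hsep h' hst).ne h
    · exact hst (h' ▸ rfl)
    · exact (hsep h' (Ne.symm hst)).ne h.symm
  · have key : ∀ {s t}, α s = α t → c ≤ s → c ≤ t := by
      intro s t h hcs
      by_contra! htc
      have hct : α c = α t := (hmono (α t)).ordConnected.out rfl h ⟨htc.le, hcs⟩
      exact htc.not_ge ((hCL hc hct).trans_le (hLle rfl))
    exact ⟨key h, key h.symm⟩


/-- In a T1 space, every monotone path (one with connected fibers) with
distinct endpoints may be replaced by an injective path with the same
endpoints and the same image. -/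
theorem monotone_path_replace_injective
    {X : Type*} [TopologicalSpace X] [T1Space X]
    (α : unitInterval → X) (hα : Continuous α) (hne : α 0 ≠ α 1)
    (hmono : ∀ x : X, IsPreconnected (α ⁻¹' {x})) :
    ∃ β : unitInterval → X, Continuous β ∧ Function.Injective β ∧
      β 0 = α 0 ∧ β 1 = α 1 ∧ Set.range β = Set.range α := by
  obtain ⟨φ, hφc, hφs, hφm, hφ⟩ := exists_monotone_continuous_same_fibers hα hne hmono
  let β : unitInterval → X := fun x => α (Function.surjInv hφs x)
  have hβ : ∀ t, β (φ t) = α t := fun t => (hφ _ _).1 (Function.surjInv_eq hφs (φ t))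
  have h0 : φ 0 = 0 := by
    obtain ⟨t, ht⟩ := hφs 0
    exact le_antisymm ((hφm unitInterval.nonneg').trans_eq ht) unitInterval.nonneg'
  have h1 : φ 1 = 1 := by
    obtain ⟨t, ht⟩ := hφs 1
    exact le_antisymm unitInterval.le_one' (ht.symm.trans_le (hφm unitInterval.le_one'))
  refine ⟨β, ?_, ?_, ?_, ?_, ?_⟩
  · rw [(hφc.isClosedMap.isQuotientMap hφc hφs).continuous_iff]
    exact hα.congr fun t => (hβ t).symm
  · intro x y hxy
    obtain ⟨s, rfl⟩ := hφs x
    obtain ⟨t, rfl⟩ := hφs y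
    rw [hβ, hβ] at hxy
    exact (hφ s t).2 hxy
  · rw [← hβ 0, h0]
  · rw [← hβ 1, h1]
  · rw [← funext hβ]
    exact (hφs.range_comp β).symm
end
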